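/- Let X be a path in ℝ^d and W ⊆ T(ℝ^d). Define W' := {Σ_{x=uv} ⟨𝒜σ(X), u⟩·v : x ∈ W}, where for each x the sum runs over the deconcatenation splittings of x into prefix u and suffix v. Then {paths Y : ⟵X ⊔ Y ∈ 𝒱(W)} = 𝒱(W'); consequently, the set of paths Y whose signature equals σ(X ⊔ Z) for some Z ∈ 𝒱(W) is exactly the path variety 𝒱(W'). (Analogously, the set of Y with σ(Y) = σ(Z ⊔ X) for some Z ∈ 𝒱(W) is the path variety 𝒱({Σ_{x=uv} u·⟨𝒜σ(X), v⟩ : x ∈ W}).) -/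

import Mathlib

open scoped BigOperators TensorProduct

namespace PathVarieties

/-- Words over an alphabet `α`; the letters `{1,…,d}` of `ℝ^d` correspond to `α = Fin d`. -/
abbrev Word (α : Type*) := List α

/-- The tensor algebra `T(ℝ^d)`, identified with the free real vector space on words. -/
abbrev TA (α : Type*) := Word α →₀ ℝ

/-- The list of all (riffle) shuffles of two words. -/
def shuffles {α : Type*} : Word α → Word α → List (Word α)
  | [], v => [v]
  | a :: u, [] => [a :: u]
  | a :: u, b :: v =>
      ((shuffles u (b :: v)).map (a :: ·)) ++ ((shuffles (a :: u) v).map (b :: ·))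
termination_by u v => u.length + v.length
decreasing_by all_goals (simp only [List.length_cons]; omega)

/-- Shuffle product of two words, as an element of `T(ℝ^d)`. -/
noncomputable def shw {α : Type*} (u v : Word α) : TA α :=
  ((shuffles u v).map fun w => Finsupp.single w (1 : ℝ)).sum

/-- The shuffle product `⧢` on `T(ℝ^d)`, the bilinear extension of the shuffle of words. -/
noncomputable def sh {α : Type*} (x y : TA α) : TA α :=
  x.sum fun u cu => y.sum fun v cv => (cu * cv) • shw u v

/-- Right halfshuffle `u ≻ v` of words (`v` nonempty): shuffle `u` with `v` minus its
last letter, then append the last letter of `v`.  (This is the unique bilinear operation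
with `w ≻ a = wa` and `w ≻ (va) = (w≻v + v≻w)a`.) -/
noncomputable def rshw {α : Type*} (u v : Word α) : TA α :=
  ((shuffles u v.dropLast).map fun w =>
    Finsupp.single (w ++ v.drop (v.length - 1)) (1 : ℝ)).sum

/-- Right halfshuffle `≻` on `T^{≥1}(ℝ^d)`, extended bilinearly. -/
noncomputable def rsh {α : Type*} (x y : TA α) : TA α :=
  x.sum fun u cu => y.sum fun v cv => (cu * cv) • rshw u v

/-- Left halfshuffle `u ≺ v` of words (`u` nonempty): the first letter of `u` followed by
the shuffle of the rest of `u` with `v`.  (This is the unique bilinear operation with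
`a ≺ w = aw` and `(av) ≺ w = a(w≺v + v≺w)`.) -/
noncomputable def lshw {α : Type*} (u v : Word α) : TA α :=
  ((shuffles u.tail v).map fun w => Finsupp.single (u.take 1 ++ w) (1 : ℝ)).sum

/-- Left halfshuffle `≺` on `T^{≥1}(ℝ^d)`, extended bilinearly. -/
noncomputable def lsh {α : Type*} (x y : TA α) : TA α :=
  x.sum fun u cu => y.sum fun v cv => (cu * cv) • lshw u v

/-- The antipode `𝒜`, with `𝒜(i₁⋯iₙ) = (−1)ⁿ iₙ⋯i₁`. -/
noncomputable def antipode {α : Type*} (x : TA α) : TA α :=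
  x.sum fun w c => Finsupp.single w.reverse (((-1 : ℝ) ^ w.length) * c)

/-- Helper for `Λ_B`: value on a reversed word. -/
noncomputable def lamRev {α β : Type*} (B : α → TA β) : Word α → TA β
  | [] => Finsupp.single [] 1
  | [i] => B i
  | i :: w => rsh (lamRev B w) (B i)

/-- `Λ_B` on a word: `Λ_B e = e`, `Λ_B i = B i`, `Λ_B (w·i) = (Λ_B w) ≻ (Λ_B i)`. -/
noncomputable def lamW {α β : Type*} (B : α → TA β) (w : Word α) : TA β :=
  lamRev B w.reverse

/-- The linear map `Λ_B : T(ℝ^t) → T(ℝ^d)` induced by `B` on letters. -/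
noncomputable def Lam {α β : Type*} (B : α → TA β) (x : TA α) : TA β :=
  x.sum fun w c => c • lamW B w

/-- `splitEmb e j n w = Σ_{w = u₁⋯uₙ} e_j(u₁) ⧢ e_{j+1}(u₂) ⧢ ⋯ ⧢ e_{j+n−1}(uₙ)`,
the sum over all splittings of `w` into `n` consecutive (possibly empty) factors,
each factor relabelled letterwise by `e`. -/
noncomputable def splitEmb {α β : Type*} (e : ℕ → α → β) : ℕ → ℕ → Word α → TA β
  | _, 0, w => if w.isEmpty then Finsupp.single ([] : Word β) (1 : ℝ) else 0
  | j, k + 1, w => ∑ m ∈ Finset.range (w.length + 1),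
      sh (Finsupp.single ((w.take m).map (e j)) (1 : ℝ)) (splitEmb e (j + 1) k (w.drop m))

/-- `Σ_{x=uv} f(u)·v`: deconcatenate, evaluate the functional `f` on prefixes. -/
noncomputable def leftAct {α : Type*} (f : Word α → ℝ) (x : TA α) : TA α :=
  x.sum fun w c => c • ∑ k ∈ Finset.range (w.length + 1),
    f (w.take k) • Finsupp.single (w.drop k) (1 : ℝ)

/-- `Σ_{x=uv} u·f(v)`: deconcatenate, evaluate the functional `f` on suffixes. -/
noncomputable def rightAct {α : Type*} (f : Word α → ℝ) (x : TA α) : TA α :=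
  x.sum fun w c => c • ∑ k ∈ Finset.range (w.length + 1),
    f (w.drop k) • Finsupp.single (w.take k) (1 : ℝ)

/-- A raw path: a time horizon `T` together with a map `ℝ → ℝ^α`
(only the restriction to `[0,T]` is relevant). -/
structure RawPath (α : Type*) where
  T : ℝ
  toFun : ℝ → α → ℝ

/-- A path: positive time horizon, continuous on `[0,T]` and piecewise continuously
differentiable there (witnessed by a partition `0 = τ₀ < τ₁ < ⋯ < τₙ = T`). -/
def IsPath {α : Type*} (X : RawPath α) : Prop :=
  0 < X.T ∧ (∀ i, ContinuousOn (fun t => X.toFun t i) (Set.Icc 0 X.T)) ∧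
    ∃ (n : ℕ) (τ : Fin (n + 1) → ℝ), StrictMono τ ∧ τ 0 = 0 ∧ τ (Fin.last n) = X.T ∧
      ∀ (k : Fin n) (i : α), ContDiffOn ℝ 1 (fun t => X.toFun t i)
        (Set.Icc (τ k.castSucc) (τ k.succ))

/-- Iterated integrals, by recursion on the reversed word:
`sigRev X (i :: w) t = ∫₀ᵗ ⟨σ(X)ₛ, w.reverse⟩ dX⁽ⁱ⁾(s)`. -/
noncomputable def sigRev {α : Type*} (X : ℝ → α → ℝ) : Word α → ℝ → ℝ
  | [], _ => 1
  | i :: w, t => ∫ s in (0 : ℝ)..t, sigRev X w s * deriv (fun u => X u i) s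

/-- `⟨σ(X)_t, w⟩`, the iterated-integrals signature of `X` stopped at time `t`. -/
noncomputable def sigUpTo {α : Type*} (X : RawPath α) (t : ℝ) (w : Word α) : ℝ :=
  sigRev X.toFun w.reverse t

/-- `⟨σ(X), w⟩`, the iterated-integrals signature of the path `X` at a word `w`. -/
noncomputable def sig {α : Type*} (X : RawPath α) (w : Word α) : ℝ :=
  sigUpTo X X.T w

/-- Pairing of a word-indexed functional with an element of `T(ℝ^d)`. -/
noncomputable def pairF {α : Type*} (f : Word α → ℝ) (x : TA α) : ℝ :=
  x.sum fun w c => c * f w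

/-- `⟨σ(X), x⟩` for a tensor `x ∈ T(ℝ^d)` (linear in `x`). -/
noncomputable def pair {α : Type*} (X : RawPath α) (x : TA α) : ℝ :=
  Finsupp.linearCombination ℝ (sig X) x

/-- The path variety `𝒱(W)` of all paths whose signature kills every element of `W`. -/
def V {α : Type*} (W : Set (TA α)) : Set (RawPath α) :=
  {X | IsPath X ∧ ∀ x ∈ W, pair X x = 0}

/-- `ℐ(M)`, the space of tensors killed by the signature of every path in `M`. -/
noncomputable def Idl {α : Type*} (M : Set (RawPath α)) : Submodule ℝ (TA α) :=
  ⨅ X ∈ M, LinearMap.ker (Finsupp.linearCombination ℝ (sig X))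

/-- Concatenation `X ⊔ Y` of paths. -/
noncomputable def concat {α : Type*} (X Y : RawPath α) : RawPath α where
  T := X.T + Y.T
  toFun := fun t i =>
    if t ≤ X.T then X.toFun t i else Y.toFun (t - X.T) i + X.toFun X.T i - Y.toFun 0 i

/-- Time reversal `⟵X`. -/
def timeRev {α : Type*} (X : RawPath α) : RawPath α :=
  ⟨X.T, fun t i => X.toFun (X.T - t) i⟩

/-- `concatIter X n = X^{⊔(n+1)}`. -/
noncomputable def concatIter {α : Type*} (X : RawPath α) : ℕ → RawPath α
  | 0 => X
  | n + 1 => concat (concatIter X n) X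

/-- `X^{⊔n}`, the `n`-fold concatenation of `X` with itself (intended for `n ≥ 1`). -/
noncomputable def concatPow {α : Type*} (X : RawPath α) (n : ℕ) : RawPath α :=
  concatIter X (n - 1)

/-- `concatFold f k = f 0 ⊔ f 1 ⊔ ⋯ ⊔ f k`. -/
noncomputable def concatFold {α : Type*} (f : ℕ → RawPath α) : ℕ → RawPath α
  | 0 => f 0
  | k + 1 => concat (concatFold f k) (f (k + 1))

/-- The deconcatenation coproduct `Δ : T(ℝ^d) → T(ℝ^d) ⊗ T(ℝ^d)`,
`Δw = Σ_{w=uv} u ⊗ v`. -/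
noncomputable def deconc {α : Type*} (x : TA α) : TensorProduct ℝ (TA α) (TA α) :=
  x.sum fun w c => c • ∑ k ∈ Finset.range (w.length + 1),
    (Finsupp.single (w.take k) (1 : ℝ)) ⊗ₜ[ℝ] (Finsupp.single (w.drop k) (1 : ℝ))


/-- The convolution product of two word-indexed functionals, dual to deconcatenation. -/
noncomputable def conv {α : Type*} (f g : Word α → ℝ) (w : Word α) : ℝ :=
  ∑ k ∈ Finset.range (w.length + 1), f (w.take k) * g (w.drop k)

/-- The counit: the unit of the convolution product. -/
noncomputable def counit {α : Type*} (w : Word α) : ℝ := if w = [] then 1 else 0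

section Convolution

variable {α : Type*}

@[simp] lemma conv_nil (f g : Word α → ℝ) : conv f g [] = f [] * g [] := by simp [conv]

lemma conv_cons (f g : Word α → ℝ) (a : α) (w : Word α) :
    conv f g (a :: w) = f [] * g (a :: w) + conv (fun u => f (a :: u)) g w := by
  rw [conv, List.length_cons, Finset.sum_range_succ', add_comm]
  simp [conv]

lemma conv_lincomb (c : ℝ) (f₁ f₂ g : Word α → ℝ) (w : Word α) :
    conv (fun u => c * f₁ u + f₂ u) g w = c * conv f₁ g w + conv f₂ g w := by
  simp [conv, add_mul, Finset.sum_add_distrib, Finset.mul_sum, mul_assoc]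

lemma conv_assoc (f g h : Word α → ℝ) (w : Word α) :
    conv (conv f g) h w = conv f (conv g h) w := by
  induction w generalizing f with
  | nil => simp [mul_assoc]
  | cons a w ih =>
    simp only [conv_cons, conv_nil, conv_lincomb, ih]
    ring

lemma counit_conv (f : Word α → ℝ) (w : Word α) : conv counit f w = f w := by
  cases w with
  | nil => simp [counit]
  | cons a w =>
    rw [conv_cons]
    simp [counit, conv]

lemma conv_reverse (f g : Word α → ℝ) (w : Word α) :
    conv f g w.reverse = conv (fun u => g u.reverse) (fun u => f u.reverse) w := by
  unfold conv
  rw [← Finset.sum_range_reflect, List.length_reverse]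
  refine Finset.sum_congr rfl fun k hk => ?_
  have hk : k ≤ w.length := by simpa [Nat.lt_succ_iff] using hk
  rw [List.take_reverse, List.drop_reverse, mul_comm]
  congr 4 <;> omega

lemma conv_counit (f : Word α → ℝ) (w : Word α) : conv f counit w = f w := by
  have h := conv_reverse f counit w.reverse
  have hc : (fun u : Word α => counit u.reverse) = counit := by
    funext u
    simp [counit]
  rw [List.reverse_reverse, hc, counit_conv, List.reverse_reverse] at h
  exact h

lemma linearCombination_leftAct (f g : Word α → ℝ) (x : TA α) :
    Finsupp.linearCombination ℝ g (leftAct f x) = Finsupp.linearCombination ℝ (conv f g) x := by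
  rw [leftAct, Finsupp.linearCombination_apply ℝ x, Finsupp.sum, map_sum, Finsupp.sum]
  simp [conv]

lemma linearCombination_rightAct (f g : Word α → ℝ) (x : TA α) :
    Finsupp.linearCombination ℝ g (rightAct f x) = Finsupp.linearCombination ℝ (conv g f) x := by
  rw [rightAct, Finsupp.linearCombination_apply ℝ x, Finsupp.sum, map_sum, Finsupp.sum]
  simp [conv, mul_comm]

end Convolution

/-- Iterated integrals of the family `f` from `a` to `t`, indexed by reversed words. -/
noncomputable def iter {α : Type*} (f : α → ℝ → ℝ) (a : ℝ) : Word α → ℝ → ℝ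
  | [], _ => 1
  | i :: w, t => ∫ s in a..t, iter f a w s * f i s

section IteratedIntegrals

open MeasureTheory Set

variable {α : Type*} {f : α → ℝ → ℝ} {a b c d t : ℝ}

lemma iter_self (f : α → ℝ → ℝ) (a : ℝ) (w : Word α) : iter f a w a = counit w := by
  cases w <;> simp [iter, counit]

lemma absolutelyContinuousOnInterval_iter (hf : ∀ i, IntervalIntegrable (f i) volume c d)
    (ha : a ∈ uIcc c d) (w : Word α) : AbsolutelyContinuousOnInterval (iter f a w) c d := by
  induction w with
  | nil => exact (LipschitzWith.const' (K := 0) (1 : ℝ)).lipschitzOnWith.absolutelyContinuousOnInterval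
  | cons i w ih =>
    exact ((hf i).continuousOn_mul
      ih.continuousOn).absolutelyContinuousOnInterval_intervalIntegral ha

lemma intervalIntegrable_iter_mul (hf : ∀ i, IntervalIntegrable (f i) volume c d)
    (ha : a ∈ uIcc c d) (w : Word α) (i : α) :
    IntervalIntegrable (fun s => iter f a w s * f i s) volume c d :=
  (hf i).continuousOn_mul (absolutelyContinuousOnInterval_iter hf ha w).continuousOn

lemma ae_hasDerivAt_iter (hf : ∀ i, IntervalIntegrable (f i) volume c d)
    (ha : a ∈ uIcc c d) (i : α) (w : Word α) :
    ∀ᵐ x, x ∈ uIcc c d → HasDerivAt (iter f a (i :: w)) (iter f a w x * f i x) x := by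
  filter_upwards [(intervalIntegrable_iter_mul hf ha w i).ae_hasDerivAt_integral] with x hx hxm
  exact hx hxm a ha

/-- Chen's identity for iterated integrals indexed by reversed words. -/
lemma iter_chen (hf : ∀ i, IntervalIntegrable (f i) volume c d) (ha : a ∈ uIcc c d)
    (hb : b ∈ uIcc c d) (w : Word α) (ht : t ∈ uIcc c d) :
    iter f a w t = conv (fun u => iter f b u t) (fun v => iter f a v b) w := by
  induction w generalizing t with
  | nil => simp [iter]
  | cons i w ih =>
    have hint : ∀ x ∈ uIcc c d, ∀ y ∈ uIcc c d, ∀ e ∈ uIcc c d, ∀ u,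
        IntervalIntegrable (fun s => iter f e u s * f i s) volume x y := fun x hx y hy e he u =>
      (intervalIntegrable_iter_mul hf he u i).mono_set (uIcc_subset_uIcc hx hy)
    have hconv : conv (fun u => iter f b (i :: u) t) (fun v => iter f a v b) w =
        ∫ s in b..t, iter f a w s * f i s := by
      have hcongr : ∫ s in b..t, iter f a w s * f i s = ∫ s in b..t,
          ∑ k ∈ Finset.range (w.length + 1),
            iter f a (w.drop k) b * (iter f b (w.take k) s * f i s) := by
        refine intervalIntegral.integral_congr fun s hs => ?_
        rw [ih (uIcc_subset_uIcc hb ht hs), conv, Finset.sum_mul]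
        exact Finset.sum_congr rfl fun k _ => by ring
      rw [hcongr, intervalIntegral.integral_finsetSum fun k _ =>
        (hint b hb t ht b hb _).const_mul _]
      refine Finset.sum_congr rfl fun k _ => ?_
      rw [intervalIntegral.integral_const_mul, mul_comm]
      rfl
    rw [conv_cons, hconv, iter, iter, iter, one_mul]
    exact (intervalIntegral.integral_add_adjacent_intervals (hint a ha b hb a ha w)
      (hint b hb t ht a ha w)).symm

/-- The functional `u ↦ (-1)^|u| ⟨iter, u.reverse ++ acc⟩` at time `t`. -/
noncomputable def iterAntipode {α : Type*} (f : α → ℝ → ℝ) (a : ℝ) (acc : Word α) (t : ℝ)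
    (u : Word α) : ℝ :=
  (-1 : ℝ) ^ u.length * iter f a (u.reverse ++ acc) t

lemma conv_iterAntipode_cons (f : α → ℝ → ℝ) (a : ℝ) (acc : Word α) (i : α) (w : Word α) (t : ℝ) :
    conv (iterAntipode f a acc t) (fun v => iter f a v t) (i :: w) =
      iter f a acc t * iter f a (i :: w) t -
        conv (iterAntipode f a (i :: acc) t) (fun v => iter f a v t) w := by
  rw [conv_cons]
  simp [iterAntipode, conv, pow_succ, Finset.sum_neg_distrib, sub_eq_add_neg]

lemma absolutelyContinuousOnInterval_conv_iterAntipode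
    (hf : ∀ i, IntervalIntegrable (f i) volume c d) (ha : a ∈ uIcc c d) (acc w : Word α) :
    AbsolutelyContinuousOnInterval
      (fun t => conv (iterAntipode f a acc t) (fun v => iter f a v t) w) c d := by
  have hac := absolutelyContinuousOnInterval_iter hf ha
  induction w generalizing acc with
  | nil => simpa [iterAntipode, iter] using hac acc
  | cons i w ih =>
    simp only [conv_iterAntipode_cons]
    exact ((hac acc).fun_mul (hac (i :: w))).fun_sub (ih (i :: acc))

lemma ae_hasDerivAt_conv_iterAntipode (hf : ∀ i, IntervalIntegrable (f i) volume c d)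
    (ha : a ∈ uIcc c d) (j : α) (acc w : Word α) :
    ∀ᵐ x, x ∈ uIcc c d → HasDerivAt
      (fun t => conv (iterAntipode f a (j :: acc) t) (fun v => iter f a v t) w)
      (iter f a acc x * f j x * iter f a w x) x := by
  induction w generalizing j acc with
  | nil => simpa [iterAntipode, iter] using ae_hasDerivAt_iter hf ha j acc
  | cons i w ih =>
    filter_upwards [ae_hasDerivAt_iter hf ha j acc, ae_hasDerivAt_iter hf ha i w,
      ih i (j :: acc)] with x h₁ h₂ h₃ hx
    simp only [conv_iterAntipode_cons]
    exact (((h₁ hx).fun_mul (h₂ hx)).fun_sub (h₃ hx)).congr_deriv (by ring)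

/-- The antipode of the iterated integrals is a left inverse for convolution. -/
lemma conv_iterAntipode_nil (hf : ∀ i, IntervalIntegrable (f i) volume c d) (ha : a ∈ uIcc c d)
    (ht : t ∈ uIcc c d) (w : Word α) :
    conv (iterAntipode f a [] t) (fun v => iter f a v t) w = counit w := by
  cases w with
  | nil => simp [iterAntipode, iter, counit]
  | cons i w =>
    obtain ⟨C, hC⟩ := (absolutelyContinuousOnInterval_conv_iterAntipode hf ha []
      (i :: w)).const_of_ae_hasDerivAt_zero (by
        filter_upwards [ae_hasDerivAt_iter hf ha i w,
          ae_hasDerivAt_conv_iterAntipode hf ha i [] w] with x h₁ h₂ hx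
        simp only [conv_iterAntipode_cons]
        refine (((hasDerivAt_const x 1).fun_mul (h₁ hx)).fun_sub (h₂ hx)).congr_deriv ?_
        simp [iter, mul_comm])
    rw [hC t ht, ← hC a ha, funext (iter_self f a), conv_counit]
    simp [iterAntipode, iter_self, counit]

/-- Running the iterated integrals backwards amounts to applying the antipode. -/
lemma iter_swap (hf : ∀ i, IntervalIntegrable (f i) volume c d) (ha : a ∈ uIcc c d)
    (hb : b ∈ uIcc c d) (w : Word α) :
    iter f b w a = (-1 : ℝ) ^ w.length * iter f a w.reverse b := by
  have hright : conv (fun v => iter f a v b) (fun u => iter f b u a) = counit := by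
    funext w
    rw [← iter_chen hf hb ha w hb, iter_self]
  have hleft : conv (iterAntipode f a [] b) (fun v => iter f a v b) = counit :=
    funext fun w => conv_iterAntipode_nil hf ha hb w
  calc iter f b w a = conv counit (fun u => iter f b u a) w := 
      (counit_conv (fun u => iter f b u a) w).symm
    _ = conv (iterAntipode f a [] b) counit w := by rw [← hleft, conv_assoc, hright, hleft]
    _ = _ := by rw [conv_counit, iterAntipode, List.append_nil]

lemma iter_congr {g : α → ℝ → ℝ} (h : ∀ i, EqOn (f i) (g i) (Ioo c d)) (ha : a ∈ Icc c d)
    (w : Word α) (ht : t ∈ Icc c d) : iter f a w t = iter g a w t := by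
  induction w generalizing t with
  | nil => rfl
  | cons i w ih =>
    refine intervalIntegral.integral_congr_uIoo fun s hs => ?_
    have hs' : s ∈ Ioo c d :=
      ⟨(le_inf ha.1 ht.1).trans_lt hs.1, hs.2.trans_le (sup_le ha.2 ht.2)⟩
    simp only [ih (Ioo_subset_Icc_self hs'), h i hs']

lemma iter_comp_sub (f : α → ℝ → ℝ) (a e : ℝ) (w : Word α) (t : ℝ) :
    iter (fun i s => f i (s - e)) (a + e) w t = iter f a w (t - e) := by
  induction w generalizing t with
  | nil => rfl
  | cons i w ih =>
    simp only [iter, ih]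
    rw [intervalIntegral.integral_comp_sub_right (fun s => iter f a w s * f i s)]
    simp

lemma iter_comp_reflect (f : α → ℝ → ℝ) (a e : ℝ) (w : Word α) (t : ℝ) :
    iter (fun i s => -f i (e - s)) (e - a) w t = iter f a w (e - t) := by
  induction w generalizing t with
  | nil => rfl
  | cons i w ih =>
    simp only [iter, ih, mul_neg, intervalIntegral.integral_neg]
    rw [intervalIntegral.integral_comp_sub_left (fun s => iter f a w s * f i s),
      ← intervalIntegral.integral_symm]
    simp

end IteratedIntegrals

section Paths

open MeasureTheory Set

variable {α : Type*} {X Y : RawPath α}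

/-- The coordinatewise derivative of a path. -/
noncomputable def velocity (X : RawPath α) (i : α) (t : ℝ) : ℝ := deriv (fun u => X.toFun u i) t

lemma sigRev_eq_iter (X : RawPath α) (w : Word α) (t : ℝ) :
    sigRev X.toFun w t = iter (velocity X) 0 w t := by
  induction w generalizing t with
  | nil => rfl
  | cons i w ih => simp only [sigRev, iter, ih, velocity]

lemma sig_eq_iter (X : RawPath α) (w : Word α) :
    sig X w = iter (velocity X) 0 w.reverse X.T := sigRev_eq_iter X _ _

lemma IsPath.intervalIntegrable_velocity (hX : IsPath X) (i : α) :
    IntervalIntegrable (velocity X i) volume 0 X.T := by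
  obtain ⟨-, -, n, τ, hτ, h0, hT, hC⟩ := hX
  have hpiece : ∀ k : Fin n,
      IntervalIntegrable (velocity X i) volume (τ k.castSucc) (τ k.succ) := fun k => by
    have hlt : τ k.castSucc < τ k.succ := hτ k.castSucc_lt_succ
    have hcont := (hC k i).continuousOn_derivWithin (uniqueDiffOn_Icc hlt) le_rfl
    refine (hcont.intervalIntegrable_of_Icc hlt.le).congr_uIoo fun s hs => ?_
    rw [uIoo_of_le hlt.le] at hs
    exact derivWithin_of_mem_nhds (Icc_mem_nhds hs.1 hs.2)
  have hall : ∀ k : Fin (n + 1), IntervalIntegrable (velocity X i) volume (τ 0) (τ k) := fun k => by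
    induction k using Fin.induction with
    | zero => exact IntervalIntegrable.refl
    | succ k ih => exact ih.trans (hpiece k)
  simpa only [h0, hT] using hall (Fin.last n)

lemma IsPath.timeRev (hX : IsPath X) : IsPath (timeRev X) := by
  obtain ⟨hpos, hcont, n, τ, hτ, h0, hT, hC⟩ := hX
  refine ⟨hpos, fun i => (hcont i).comp (by fun_prop) fun t (ht : t ∈ Icc 0 X.T) => ?_, n,
    fun k => X.T - τ k.rev, fun k l hkl => ?_, ?_, ?_, fun k i => ?_⟩
  · exact ⟨by linarith [ht.2], by linarith [ht.1]⟩
  · exact sub_lt_sub_left (hτ (Fin.rev_lt_rev.mpr hkl)) _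
  · simp [hT]
  · simp [h0, PathVarieties.timeRev]
  · refine (hC k.rev i).comp (g := fun t => X.toFun t i) (f := fun t => X.T - t)
      (by fun_prop) fun t ht => ?_
    simp only [Fin.rev_castSucc, Fin.rev_succ] at ht
    exact ⟨by linarith [ht.2], by linarith [ht.1]⟩

lemma concat_eqOn_left (X Y : RawPath α) (i : α) :
    EqOn (fun t => (concat X Y).toFun t i) (fun t => X.toFun t i) (Iic X.T) :=
  fun _ ht => if_pos ht

lemma concat_eqOn_right (X Y : RawPath α) (i : α) :
    EqOn (fun t => (concat X Y).toFun t i)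
      (fun t => Y.toFun (t - X.T) i + X.toFun X.T i - Y.toFun 0 i) (Ici X.T) := fun t ht => by
  rcases (mem_Ici.mp ht).eq_or_lt with rfl | h
  · simp [concat]
  · exact if_neg h.not_ge

lemma IsPath.concat (hX : IsPath X) (hY : IsPath Y) : IsPath (concat X Y) := by
  obtain ⟨hpos, hcont, n, τ, hτ, h0, hT, hC⟩ := hX
  obtain ⟨hpos', hcont', m, τ', hτ', h0', hT', hC'⟩ := hY
  have hright : ∀ k : Fin (m + 1), 0 ≤ τ' k := fun k => h0' ▸ hτ'.monotone (Fin.zero_le k)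
  have hleft : ∀ k : Fin (n + 1), τ k ≤ X.T := fun k => hT ▸ hτ.monotone (Fin.le_last k)
  let σ : Fin (n + m + 1) → ℝ := fun k =>
    if h : k.val ≤ n then τ ⟨k, by omega⟩ else X.T + τ' ⟨k - n, by omega⟩
  have hσ : ∀ k : Fin (n + m + 1), ∀ h : n ≤ k.val, σ k = X.T + τ' ⟨k - n, by omega⟩ := by
    intro k h
    rcases h.eq_or_lt with h | h
    · have e₁ : (⟨k, by omega⟩ : Fin (n + 1)) = Fin.last n := Fin.ext h.symm
      have e₂ : (⟨k - n, by omega⟩ : Fin (m + 1)) = 0 := Fin.ext (by simp [← h])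
      simp only [σ, dif_pos h.ge, e₁, e₂, hT, h0', add_zero]
    · exact dif_neg (by omega)
  refine ⟨add_pos hpos hpos', fun i => ?_, n + m, σ, ?_, ?_, ?_, fun k i => ?_⟩
  · have hsplit : Icc 0 (PathVarieties.concat X Y).T = Icc 0 X.T ∪ Icc X.T (X.T + Y.T) :=
      (Icc_union_Icc_eq_Icc hpos.le (le_add_of_nonneg_right hpos'.le)).symm
    rw [hsplit]
    refine ContinuousOn.union_of_isClosed ?_ ?_ isClosed_Icc isClosed_Icc
    · exact (hcont i).congr ((concat_eqOn_left X Y i).mono Icc_subset_Iic_self)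
    · refine ContinuousOn.congr ?_ ((concat_eqOn_right X Y i).mono Icc_subset_Ici_self)
      refine (((hcont' i).comp (f := fun t => t - X.T) (by fun_prop) fun t ht => ?_).add
        continuousOn_const).sub continuousOn_const
      exact ⟨by linarith [ht.1], by linarith [ht.2]⟩
  · refine Fin.strictMono_iff_lt_succ.mpr fun k => ?_
    rcases lt_or_ge k.val n with h | h
    · simp only [σ, Fin.val_castSucc, Fin.val_succ, dif_pos h.le, dif_pos (Nat.succ_le_of_lt h)]
      exact hτ (Fin.mk_lt_mk.mpr (Nat.lt_succ_self _))
    · rw [hσ _ h, hσ _ (by simp; omega)]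
      refine add_lt_add_right (hτ' (Fin.mk_lt_mk.mpr ?_)) _
      simp
      omega
  · simpa [σ] using h0
  · rw [hσ _ (by simp)]
    simpa [PathVarieties.concat, Fin.last] using hT'
  · rcases lt_or_ge k.val n with h | h
    · have hs : Icc (σ k.castSucc) (σ k.succ) =
          Icc (τ (Fin.castSucc ⟨k, h⟩)) (τ (Fin.succ ⟨k, h⟩)) := by
        simp only [σ, Fin.val_castSucc, Fin.val_succ, dif_pos h.le, dif_pos (Nat.succ_le_of_lt h)]
        rfl
      rw [hs]
      exact (hC ⟨k, h⟩ i).congr fun t ht => concat_eqOn_left X Y i (ht.2.trans (hleft _))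
    · have hk : k.val - n < m := by omega
      have hs : Icc (σ k.castSucc) (σ k.succ) =
          Icc (X.T + τ' (Fin.castSucc ⟨k - n, hk⟩)) (X.T + τ' (Fin.succ ⟨k - n, hk⟩)) := by
        rw [hσ _ h, hσ _ (by simp; omega)]
        congr 4
        simp
        omega
      rw [hs]
      refine ContDiffOn.congr ?_ fun t ht =>
        concat_eqOn_right X Y i (le_trans (le_add_of_nonneg_right (hright _)) ht.1)
      refine (((hC' ⟨k - n, hk⟩ i).comp (f := fun t => t - X.T) (by fun_prop)
        fun t ht => ?_).add contDiffOn_const).sub contDiffOn_const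
      exact ⟨by linarith [ht.1], by linarith [ht.2]⟩

lemma velocity_concat_left (X Y : RawPath α) (i : α) :
    EqOn (velocity (concat X Y) i) (velocity X i) (Iio X.T) := fun _ ht =>
  Filter.EventuallyEq.deriv_eq <|
    (concat_eqOn_left X Y i).eventuallyEq_of_mem (Iic_mem_nhds ht)

lemma velocity_concat_right (X Y : RawPath α) (i : α) :
    EqOn (velocity (concat X Y) i) (fun s => velocity Y i (s - X.T)) (Ioi X.T) := fun t ht => by
  have h := Filter.EventuallyEq.deriv_eq <|
    (concat_eqOn_right X Y i).eventuallyEq_of_mem (Ici_mem_nhds ht)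
  rw [deriv_sub_const, deriv_add_const, deriv_comp_sub_const (f := fun u => Y.toFun u i)] at h
  exact h

lemma IsPath.sig_concat (hX : IsPath X) (hY : IsPath Y) :
    sig (PathVarieties.concat X Y) = conv (sig X) (sig Y) := by
  funext w
  have hXT := hX.1
  have hYT := hY.1
  have hle : (0 : ℝ) ≤ X.T + Y.T := by linarith
  have hb : X.T ∈ uIcc 0 (X.T + Y.T) := by
    rw [uIcc_of_le hle]
    exact ⟨hXT.le, by linarith⟩
  have hleft : ∀ u, iter (velocity (PathVarieties.concat X Y)) 0 u X.T =
      iter (velocity X) 0 u X.T := fun u =>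
    iter_congr (fun i => (velocity_concat_left X Y i).mono Ioo_subset_Iio_self)
      (left_mem_Icc.mpr hXT.le) u (right_mem_Icc.mpr hXT.le)
  have hright : ∀ u, iter (velocity (PathVarieties.concat X Y)) X.T u (X.T + Y.T) =
      iter (velocity Y) 0 u Y.T := fun u => by
    have hXY : X.T ≤ X.T + Y.T := by linarith
    rw [iter_congr (fun i => (velocity_concat_right X Y i).mono Ioo_subset_Ioi_self)
      (left_mem_Icc.mpr hXY) u (right_mem_Icc.mpr hXY)]
    simpa using iter_comp_sub (velocity Y) 0 X.T u (X.T + Y.T)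
  rw [sig_eq_iter]
  change iter _ 0 w.reverse (X.T + Y.T) = _
  have hint : ∀ i, IntervalIntegrable (velocity (PathVarieties.concat X Y) i) volume 0
      (X.T + Y.T) := (hX.concat hY).intervalIntegrable_velocity
  rw [iter_chen hint left_mem_uIcc hb _ right_mem_uIcc, conv_reverse]
  simp only [hleft, hright, ← sig_eq_iter]

lemma sig_timeRev_eq_iter (X : RawPath α) (w : Word α) :
    sig (timeRev X) w = iter (velocity X) X.T w.reverse 0 := by
  have hv : velocity (timeRev X) = fun i s => -velocity X i (X.T - s) := by
    funext i s
    exact deriv_comp_const_sub (f := fun u => X.toFun u i) X.T s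
  have h := iter_comp_reflect (velocity X) X.T X.T w.reverse X.T
  rw [sub_self] at h
  rw [sig_eq_iter, hv]
  exact h

lemma IsPath.sig_timeRev (hX : IsPath X) :
    sig (PathVarieties.timeRev X) = fun w => (-1 : ℝ) ^ w.length * sig X w.reverse := by
  funext w
  rw [sig_timeRev_eq_iter, iter_swap hX.intervalIntegrable_velocity left_mem_uIcc right_mem_uIcc,
    sig_eq_iter, List.length_reverse]

lemma IsPath.conv_sig_timeRev (hX : IsPath X) :
    conv (sig X) (sig (PathVarieties.timeRev X)) = counit := by
  funext w
  have h := iter_chen hX.intervalIntegrable_velocity left_mem_uIcc right_mem_uIcc w.reverse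
    left_mem_uIcc
  rw [conv_reverse, iter_self] at h
  simp only [← sig_eq_iter, ← sig_timeRev_eq_iter] at h
  simpa [counit] using h.symm

lemma IsPath.conv_timeRev_sig (hX : IsPath X) :
    conv (sig (PathVarieties.timeRev X)) (sig X) = counit := by
  funext w
  have h := iter_chen hX.intervalIntegrable_velocity right_mem_uIcc left_mem_uIcc w.reverse
    right_mem_uIcc
  rw [conv_reverse, iter_self] at h
  simp only [← sig_eq_iter, ← sig_timeRev_eq_iter] at h
  simpa [counit] using h.symm

lemma mem_V_image_leftAct_iff (hX : IsPath X) (W : Set (TA α)) :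
    Y ∈ V ((leftAct fun w => (-1 : ℝ) ^ w.length * sig X w.reverse) '' W) ↔
      IsPath Y ∧ PathVarieties.concat (PathVarieties.timeRev X) Y ∈ V W := by
  refine and_congr_right fun hY => ?_
  simp only [V, mem_ofPred_eq, forall_mem_image, pair, hX.timeRev.concat hY, true_and,
    linearCombination_leftAct, hX.timeRev.sig_concat hY, hX.sig_timeRev]

lemma mem_V_image_rightAct_iff (hX : IsPath X) (W : Set (TA α)) :
    Y ∈ V ((rightAct fun w => (-1 : ℝ) ^ w.length * sig X w.reverse) '' W) ↔
      IsPath Y ∧ PathVarieties.concat Y (PathVarieties.timeRev X) ∈ V W := by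
  refine and_congr_right fun hY => ?_
  simp only [V, mem_ofPred_eq, forall_mem_image, pair, hY.concat hX.timeRev, true_and,
    linearCombination_rightAct, hY.sig_concat hX.timeRev, hX.sig_timeRev]

lemma mem_V_of_sig_eq {W : Set (TA α)} (hY : IsPath Y) (h : sig Y = sig X) (hX : X ∈ V W) :
    Y ∈ V W :=
  ⟨hY, fun x hx => by simpa only [pair, h] using hX.2 x hx⟩

end Paths

/-- For a path `X` and `W ⊆ T(ℝ^d)`, with
`W' = {Σ_{x=uv} ⟨𝒜σ(X),u⟩·v : x ∈ W}`: the paths `Y` with `⟵X ⊔ Y ∈ 𝒱(W)` form exactly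
`𝒱(W')`; consequently the paths `Y` with `σ(Y) = σ(X ⊔ Z)` for some `Z ∈ 𝒱(W)` form
`𝒱(W')`, and analogously the paths `Y` with `σ(Y) = σ(Z ⊔ X)` for some `Z ∈ 𝒱(W)` form
`𝒱({Σ_{x=uv} u·⟨𝒜σ(X),v⟩ : x ∈ W})`. -/
theorem statement3 {d : ℕ} (X : RawPath (Fin d)) (hX : IsPath X)
    (W : Set (TA (Fin d))) :
    ({Y : RawPath (Fin d) | IsPath Y ∧ concat (timeRev X) Y ∈ V W} =
        V ((leftAct fun w => ((-1 : ℝ) ^ w.length) * sig X w.reverse) '' W)) ∧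
    ({Y : RawPath (Fin d) | IsPath Y ∧ ∃ Z ∈ V W, ∀ w, sig Y w = sig (concat X Z) w} =
        V ((leftAct fun w => ((-1 : ℝ) ^ w.length) * sig X w.reverse) '' W)) ∧
    ({Y : RawPath (Fin d) | IsPath Y ∧ ∃ Z ∈ V W, ∀ w, sig Y w = sig (concat Z X) w} =
        V ((rightAct fun w => ((-1 : ℝ) ^ w.length) * sig X w.reverse) '' W)) := by
  refine ⟨?_, ?_, ?_⟩
  · ext Y
    exact (mem_V_image_leftAct_iff hX W).symm
  · ext Y
    rw [mem_V_image_leftAct_iff hX W]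
    refine and_congr_right fun hY => ⟨?_, fun hZ => ⟨_, hZ, congrFun ?_⟩⟩
    · rintro ⟨Z, hZ, h⟩
      refine mem_V_of_sig_eq (hX.timeRev.concat hY) ?_ hZ
      rw [hX.timeRev.sig_concat hY, funext h, hX.sig_concat hZ.1, ← funext (conv_assoc _ _ _),
        hX.conv_timeRev_sig, funext (counit_conv _)]
    · rw [hX.sig_concat hZ.1, hX.timeRev.sig_concat hY, ← funext (conv_assoc _ _ _),
        hX.conv_sig_timeRev, funext (counit_conv _)]
  · ext Y
    rw [mem_V_image_rightAct_iff hX W]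
    refine and_congr_right fun hY => ⟨?_, fun hZ => ⟨_, hZ, congrFun ?_⟩⟩
    · rintro ⟨Z, hZ, h⟩
      refine mem_V_of_sig_eq (hY.concat hX.timeRev) ?_ hZ
      rw [hY.sig_concat hX.timeRev, funext h, hZ.1.sig_concat hX, funext (conv_assoc _ _ _),
        hX.conv_sig_timeRev, funext (conv_counit _)]
    · rw [hZ.1.sig_concat hX, hY.sig_concat hX.timeRev, funext (conv_assoc _ _ _),
        hX.conv_timeRev_sig, funext (conv_counit _)]

end PathVarieties
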